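/- Let X be a real Banach space, U a strongly continuous one-parameter group of linear isometries of X, 0 ≤ s < T, M ≥ 0, B : [s,T] → L(X) continuous with ‖B(t)‖ ≤ M, and let S_B denote the associated evolution operator. Let h : [s,T] → X be Bochner integrable and w_s ∈ X. Then a function w ∈ C([s,T],X) satisfies w(t) = U(t−s)w_s + ∫_s^t U(t−τ)(B(τ)(w(τ)) + h(τ)) dτ for all t ∈ [s,T] if and only if w(t) = S_B(t,s)w_s + ∫_s^t S_B(t,τ)(h(τ)) dτ for all t ∈ [s,T]. Moreover such a w exists, is unique, and satisfies sup_{t∈[s,T]} ‖w(t)‖ ≤ e^{M(T−s)} (‖w_s‖ + ∫_s^T ‖h(τ)‖ dτ). -/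

import Mathlib

open MeasureTheory Set

namespace Duh

lemma gronwall {a b K M : ℝ} (hM : 0 ≤ M) {f : ℝ → ℝ} (hf : ContinuousOn f (Icc a b))
    (hle : ∀ t ∈ Icc a b, f t ≤ K + M * ∫ τ in a..t, f τ) :
    ∀ t ∈ Icc a b, f t ≤ Real.exp (M * (t - a)) * K := by
  intro t ht
  have hab : a ≤ b := ht.1.trans ht.2
  set g : ℝ → ℝ := IccExtend hab ((Icc a b).domRestrict f) with hg
  have hgc : Continuous g := (continuousOn_iff_continuous_domRestrict.1 hf).Icc_extend'
  have hgf : ∀ τ ∈ Icc a b, g τ = f τ := fun τ hτ => by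
    rw [hg, IccExtend_of_mem _ _ hτ]; rfl
  have hint : ∀ t ∈ Icc a b, ∫ τ in a..t, g τ = ∫ τ in a..t, f τ := by
    intro t ht
    apply intervalIntegral.integral_congr
    intro τ hτ
    rw [uIcc_of_le ht.1] at hτ
    exact hgf τ ⟨hτ.1, hτ.2.trans ht.2⟩
  set G : ℝ → ℝ := fun t => Real.exp (-(M * (t - a))) * (K + M * ∫ τ in a..t, g τ) with hG
  have hd : ∀ t, HasDerivAt G (Real.exp (-(M * (t - a))) * (-(M * 1)) * (K + M * ∫ τ in a..t, g τ)
      + Real.exp (-(M * (t - a))) * (M * g t)) t := by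
    intro t
    have h1 : HasDerivAt (fun t => ∫ τ in a..t, g τ) (g t) t :=
      intervalIntegral.integral_hasDerivAt_right (hgc.intervalIntegrable _ _)
        (hgc.stronglyMeasurableAtFilter _ _) hgc.continuousAt
    have h2 : HasDerivAt (fun t : ℝ => Real.exp (-(M * (t - a))))
      (Real.exp (-(M * (t - a))) * (-(M * 1))) t :=
      ((((hasDerivAt_id t).sub_const a).const_mul M).neg).exp
    exact h2.mul ((h1.const_mul M).const_add K)
  have hanti : AntitoneOn G (Icc a b) := by
    apply antitoneOn_of_deriv_nonpos (convex_Icc a b)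
    · exact fun x _ => (hd x).continuousAt.continuousWithinAt
    · exact fun x _ => (hd x).differentiableAt.differentiableWithinAt
    · intro x hx
      rw [interior_Icc] at hx
      have hx' := Ioo_subset_Icc_self hx
      rw [(hd x).deriv]
      have := hle x hx'
      rw [← hint x hx', ← hgf x hx'] at this
      have h3 : 0 ≤ Real.exp (-(M * (x - a))) * (M * ((K + M * ∫ τ in a..x, g τ) - g x)) := by
        have : 0 ≤ (K + M * ∫ τ in a..x, g τ) - g x := by linarith
        positivity
      linarith
  have h4 := hanti (left_mem_Icc.2 hab) ht ht.1
  simp only [hG, sub_self, mul_zero, neg_zero, Real.exp_zero, intervalIntegral.integral_same,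
    add_zero, one_mul] at h4
  have h5 := hle t ht
  rw [← hint t ht] at h5
  refine h5.trans ?_
  calc K + M * ∫ τ in a..t, g τ
      = Real.exp (M * (t - a)) * (Real.exp (-(M * (t - a))) * (K + M * ∫ τ in a..t, g τ)) := by
        rw [← mul_assoc, ← Real.exp_add]; simp
    _ ≤ _ := by gcongr

variable {X : Type*} [NormedAddCommGroup X] [NormedSpace ℝ X]

/-- strongly continuous and uniformly bounded gives joint continuity -/
lemma joint {P : Type*} [TopologicalSpace P] {A : P → X →L[ℝ] X} {C : ℝ}
    (hA : ∀ p x, ‖A p x‖ ≤ C * ‖x‖) (hc : ∀ x, Continuous fun p => A p x) :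
    Continuous fun q : P × X => A q.1 q.2 := by
  rw [continuous_iff_continuousAt]
  rintro ⟨p, x⟩
  rw [ContinuousAt, tendsto_iff_norm_sub_tendsto_zero]
  have h1 : Filter.Tendsto (fun q : P × X => C * ‖q.2 - x‖ + ‖A q.1 x - A p x‖)
      (nhds (p, x)) (nhds 0) := by
    have : Continuous (fun q : P × X => C * ‖q.2 - x‖ + ‖A q.1 x - A p x‖) := by
      have := (hc x).comp (continuous_fst (X := P) (Y := X))
      simp only [Function.comp_def] at this
      fun_prop
    simpa using this.tendsto (p, x)
  refine squeeze_zero (fun _ => norm_nonneg _) (fun q => ?_) h1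
  calc ‖A q.1 q.2 - A p x‖ = ‖A q.1 (q.2 - x) + (A q.1 x - A p x)‖ := by
        rw [map_sub]; congr 1; abel
    _ ≤ _ := (norm_add_le _ _).trans (by gcongr; exact hA _ _)

lemma Ujoint {U : ℝ → X →L[ℝ] X} (hUiso : ∀ (t : ℝ) (x : X), ‖U t x‖ = ‖x‖)
    (hUcont : ∀ x : X, Continuous fun t : ℝ => U t x) :
    Continuous fun q : ℝ × X => U q.1 q.2 :=
  joint (C := 1) (fun p x => by simp [hUiso]) hUcont

lemma kcont {U B : ℝ → X →L[ℝ] X} (hUiso : ∀ (t : ℝ) (x : X), ‖U t x‖ = ‖x‖)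
    (hUcont : ∀ x : X, Continuous fun t : ℝ => U t x) (hB : Continuous B)
    {w : ℝ → X} {A : Set ℝ} (hw : ContinuousOn w A) (t : ℝ) :
    ContinuousOn (fun τ => U (t - τ) (B τ (w τ))) A := by
  have h1 : ContinuousOn (fun τ => B τ (w τ)) A := hB.continuousOn.clm_apply hw
  exact (Ujoint hUiso hUcont).comp_continuousOn
    (ContinuousOn.prodMk (by fun_prop : ContinuousOn (fun τ => t - τ) A) h1)

lemma kbound {U B : ℝ → X →L[ℝ] X} (hUiso : ∀ (t : ℝ) (x : X), ‖U t x‖ = ‖x‖)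
    {M : ℝ} (hBM : ∀ t, ‖B t‖ ≤ M) (r t : ℝ) (x : X) : ‖U r (B t x)‖ ≤ M * ‖x‖ := by
  rw [hUiso]; exact (B t).le_of_opNorm_le (hBM t) x

lemma intbound {U B : ℝ → X →L[ℝ] X} (hUiso : ∀ (t : ℝ) (x : X), ‖U t x‖ = ‖x‖)
    {M : ℝ} (hBM : ∀ t, ‖B t‖ ≤ M) {a b : ℝ} {w : ℝ → X} (hw : ContinuousOn w (Icc a b))
    {t : ℝ} (ht : t ∈ Icc a b) :
    ‖∫ τ in a..t, U (t - τ) (B τ (w τ))‖ ≤ M * ∫ τ in a..t, ‖w τ‖ := by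
  rw [← intervalIntegral.integral_const_mul]
  apply intervalIntegral.norm_integral_le_of_norm_le ht.1
  · exact Filter.Eventually.of_forall fun τ _ => kbound hUiso hBM _ _ _
  · apply ContinuousOn.intervalIntegrable
    rw [uIcc_of_le ht.1]
    exact continuousOn_const.mul (hw.mono (Icc_subset_Icc_right ht.2)).norm

lemma uniq {U B : ℝ → X →L[ℝ] X} (hUiso : ∀ (t : ℝ) (x : X), ‖U t x‖ = ‖x‖)
    (hUcont : ∀ x : X, Continuous fun t : ℝ => U t x) (hB : Continuous B)
    {M : ℝ} (hM : 0 ≤ M) (hBM : ∀ t, ‖B t‖ ≤ M) {a b : ℝ} {w₁ w₂ g : ℝ → X}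
    (h₁ : ContinuousOn w₁ (Icc a b)) (h₂ : ContinuousOn w₂ (Icc a b))
    (e₁ : ∀ t ∈ Icc a b, w₁ t = g t + ∫ τ in a..t, U (t - τ) (B τ (w₁ τ)))
    (e₂ : ∀ t ∈ Icc a b, w₂ t = g t + ∫ τ in a..t, U (t - τ) (B τ (w₂ τ))) :
    EqOn w₁ w₂ (Icc a b) := by
  intro t ht
  have := gronwall (K := 0) hM (h₁.sub h₂).norm (fun t ht => by
    have hi : ∀ {w : ℝ → X}, ContinuousOn w (Icc a b) →
        IntervalIntegrable (fun τ => U (t - τ) (B τ (w τ))) volume a t := fun hw => by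
      apply ContinuousOn.intervalIntegrable
      rw [uIcc_of_le ht.1]
      exact kcont hUiso hUcont hB (hw.mono (Icc_subset_Icc_right ht.2)) t
    have hd : w₁ t - w₂ t = ∫ τ in a..t, U (t - τ) (B τ ((w₁ - w₂) τ)) := by
      rw [e₁ t ht, e₂ t ht, add_sub_add_left_eq_sub, ← intervalIntegral.integral_sub (hi h₁) (hi h₂)]
      simp
    simp only [Pi.sub_apply]
    rw [hd, zero_add]
    exact intbound hUiso hBM (h₁.sub h₂) ht) t ht
  simp only [mul_zero, Pi.sub_apply] at this
  exact sub_eq_zero.1 (norm_le_zero_iff.1 this)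

lemma Sbound {U B : ℝ → X →L[ℝ] X} (hUiso : ∀ (t : ℝ) (x : X), ‖U t x‖ = ‖x‖)
    {M : ℝ} (hM : 0 ≤ M) (hBM : ∀ t, ‖B t‖ ≤ M) {a b : ℝ} {w : ℝ → X} {x : X}
    (hw : ContinuousOn w (Icc a b))
    (e : ∀ t ∈ Icc a b, w t = U (t - a) x + ∫ τ in a..t, U (t - τ) (B τ (w τ))) :
    ∀ t ∈ Icc a b, ‖w t‖ ≤ Real.exp (M * (t - a)) * ‖x‖ := by
  apply gronwall hM hw.norm
  intro t ht
  calc ‖w t‖ = ‖U (t - a) x + ∫ τ in a..t, U (t - τ) (B τ (w τ))‖ := by rw [← e t ht]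
    _ ≤ _ := (norm_add_le _ _).trans (by
        rw [hUiso]; gcongr; exact intbound hUiso hBM hw ht)

section core
variable [CompleteSpace X] {U B : ℝ → X →L[ℝ] X}
    (hU0 : U 0 = ContinuousLinearMap.id ℝ X)
    (hUadd : ∀ a b : ℝ, U (a + b) = (U a).comp (U b))
    (hUiso : ∀ (t : ℝ) (x : X), ‖U t x‖ = ‖x‖)
    (hUcont : ∀ x : X, Continuous fun t : ℝ => U t x)
    {s T M : ℝ} (hsT : s < T) (hM : 0 ≤ M)
    (hB : Continuous B) (hBM : ∀ t, ‖B t‖ ≤ M)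
    {S : ℝ → ℝ → X →L[ℝ] X}
    (hScont : ∀ s' ∈ Icc s T, ∀ x : X, ContinuousOn (fun t => S t s' x) (Icc s' T))
    (hSeq : ∀ s' ∈ Icc s T, ∀ x : X, ∀ t ∈ Icc s' T,
      S t s' x = U (t - s') x + ∫ τ in s'..t, U (t - τ) (B τ (S τ s' x)))

include hUadd hUiso hUcont hM hB hBM hScont hSeq in
lemma Scomp {a c t : ℝ} (ha : s ≤ a) (hac : a ≤ c) (hct : c ≤ t) (htT : t ≤ T) (x : X) :
    S t c (S c a x) = S t a x := by
  have haT : a ∈ Icc s T := ⟨ha, by linarith⟩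
  have hcT : c ∈ Icc s T := ⟨by linarith, by linarith⟩
  have hsub : Icc c T ⊆ Icc a T := Icc_subset_Icc_left hac
  refine uniq (a := c) (b := T) (w₁ := fun t => S t c (S c a x)) (w₂ := fun t => S t a x)
    (g := fun t => U (t - c) (S c a x)) hUiso hUcont hB hM hBM
    (hScont c hcT _) ((hScont a haT x).mono hsub) (hSeq c hcT _) ?_ ⟨hct, htT⟩
  intro t ht
  have hk := kcont hUiso hUcont hB (hScont a haT x)
  have hi : ∀ r u v, a ≤ u → u ≤ v → v ≤ T →
      IntervalIntegrable (fun τ => U (r - τ) (B τ (S τ a x))) volume u v := by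
    intro r u v h1 h2 h3
    apply ContinuousOn.intervalIntegrable
    rw [uIcc_of_le h2]
    exact (hk r).mono (Icc_subset_Icc h1 h3)
  rw [hSeq a haT x t (hsub ht), hSeq a haT x c ⟨hac, hcT.2⟩, map_add,
    ← ContinuousLinearMap.intervalIntegral_comp_comm _ (hi c a c le_rfl hac hcT.2),
    ← intervalIntegral.integral_add_adjacent_intervals (hi t a c le_rfl hac hcT.2)
      (hi t c t hac ht.1 ht.2)]
  have hUU : ∀ r y, U (t - c) (U (c - r) y) = U (t - r) y := fun r y => by
    rw [← ContinuousLinearMap.comp_apply, ← hUadd]; congr 2; ring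
  simp only [hUU]
  rw [add_assoc]

include hUiso hM hBM hScont hSeq in
lemma SboundC {a t : ℝ} (ha : s ≤ a) (hat : a ≤ t) (htT : t ≤ T) (x : X) :
    ‖S t a x‖ ≤ Real.exp (M * (T - s)) * ‖x‖ := by
  have haT : a ∈ Icc s T := ⟨ha, by linarith⟩
  refine (Sbound hUiso hM hBM (hScont a haT x) (hSeq a haT x) t ⟨hat, htT⟩).trans ?_
  gcongr

include hU0 hSeq in
lemma Sdiag {a : ℝ} (ha : a ∈ Icc s T) (x : X) : S a a x = x := by
  rw [hSeq a ha x a ⟨le_rfl, ha.2⟩]; simp [hU0]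

include hUiso hM hBM hScont hSeq in
lemma Snear {a t : ℝ} (ha : s ≤ a) (hat : a ≤ t) (htT : t ≤ T) (x : X) :
    ‖S t a x - x‖ ≤ ‖U (t - a) x - x‖ + M * (Real.exp (M * (T - s)) * ‖x‖) * (t - a) := by
  have haT : a ∈ Icc s T := ⟨ha, by linarith⟩
  have h1 : ‖∫ τ in a..t, U (t - τ) (B τ (S τ a x))‖ ≤
      M * (Real.exp (M * (T - s)) * ‖x‖) * |t - a| := by
    apply intervalIntegral.norm_integral_le_of_norm_le_const
    intro τ hτ
    rw [uIoc_of_le hat] at hτ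
    refine (kbound hUiso hBM _ _ _).trans ?_
    gcongr
    exact SboundC hUiso hM hBM hScont hSeq ha hτ.1.le (hτ.2.trans htT) x
  rw [abs_of_nonneg (by linarith)] at h1
  rw [hSeq a haT x t ⟨hat, htT⟩, add_sub_right_comm]
  exact (norm_add_le _ _).trans (by gcongr)

/-- clamp -/
def cl (s T t : ℝ) : ℝ := max s (min T t)

lemma cl_cont (s T : ℝ) : Continuous (cl s T) := by unfold cl; fun_prop

lemma cl_mem {s T : ℝ} (h : s ≤ T) (t : ℝ) : cl s T t ∈ Icc s T :=
  ⟨le_max_left _ _, max_le h (min_le_left _ _)⟩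

lemma cl_eq {s T t : ℝ} (h : t ∈ Icc s T) : cl s T t = t := by
  unfold cl; rw [min_eq_right h.2, max_eq_right h.1]

/-- extension of the evolution operator -/
def Se (S : ℝ → ℝ → X →L[ℝ] X) (s T : ℝ) (q : ℝ × ℝ) : X →L[ℝ] X :=
  S (max (cl s T q.1) (cl s T q.2)) (cl s T q.2)

omit [CompleteSpace X] in
lemma Se_eq {t τ : ℝ} (h1 : s ≤ τ) (h2 : τ ≤ t) (h3 : t ≤ T) : Se S s T (t, τ) = S t τ := by
  simp only [Se]
  rw [cl_eq (t := t) ⟨h1.trans h2, h3⟩, cl_eq (t := τ) ⟨h1, h2.trans h3⟩, max_eq_left h2]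

include hUiso hM hBM hScont hSeq hsT in
lemma Se_bound (q : ℝ × ℝ) (x : X) : ‖Se S s T q x‖ ≤ Real.exp (M * (T - s)) * ‖x‖ :=
  SboundC hUiso hM hBM hScont hSeq (cl_mem hsT.le _).1 (le_max_right _ _)
    (max_le (cl_mem hsT.le _).2 (cl_mem hsT.le _).2) x

include hU0 hUadd hUiso hUcont hM hB hBM hScont hSeq in
lemma Sdiff {a c t : ℝ} (ha : s ≤ a) (hac : a ≤ c) (hcT : c ≤ T) (hst : s ≤ t) (htT : t ≤ T)
    (x : X) :
    ‖S (max t a) a x - S (max t c) c x‖ ≤ Real.exp (M * (T - s)) *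
      (‖U (max a (min t c) - a) x - x‖ +
        M * (Real.exp (M * (T - s)) * ‖x‖) * (max a (min t c) - a)) := by
  have hS := fun {a : ℝ} (ha : a ∈ Icc s T) (x : X) => Sdiag hU0 hSeq ha x
  have hsT' : s ≤ T := by linarith
  have hC : 1 ≤ Real.exp (M * (T - s)) :=
    Real.one_le_exp (mul_nonneg hM (by linarith))
  have key : ∀ d, a ≤ d → d ≤ T → ‖S d a x - x‖ ≤ Real.exp (M * (T - s)) *
      (‖U (d - a) x - x‖ + M * (Real.exp (M * (T - s)) * ‖x‖) * (d - a)) := by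
    intro d h1 h2
    refine (Snear hUiso hM hBM hScont hSeq ha h1 h2 x).trans (le_mul_of_one_le_left ?_ hC)
    have : 0 ≤ d - a := by linarith
    positivity
  rcases le_total t c with h | h
  · rw [max_eq_right h, hS ⟨by linarith, hcT⟩, min_eq_left h, max_comm t a]
    exact key _ (le_max_left _ _) (max_le (by linarith) htT)
  · rw [max_eq_left h, min_eq_right h, max_eq_right hac, max_eq_left (hac.trans h),
      ← Scomp hUadd hUiso hUcont hM hB hBM hScont hSeq ha hac h htT, ← map_sub]
    refine (SboundC hUiso hM hBM hScont hSeq (ha.trans hac) h htT _).trans ?_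
    gcongr
    exact Snear hUiso hM hBM hScont hSeq ha hac hcT x

include hU0 hUadd hUiso hUcont hsT hM hB hBM hScont hSeq in
lemma Se_cont (x : X) : Continuous fun q => Se S s T q x := by
  rw [continuous_iff_continuousAt]
  rintro ⟨t0, τ0⟩
  rw [ContinuousAt, tendsto_iff_norm_sub_tendsto_zero]
  set C := Real.exp (M * (T - s)) with hC
  let e : ℝ → ℝ := fun δ => C * (‖U δ x - x‖ + M * (C * ‖x‖) * δ)
  have he : Continuous e := by
    have := hUcont x
    fun_prop
  have he0 : e 0 = 0 := by simp [e, hU0]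
  have hc0 := cl_cont s T
  set b := cl s T τ0 with hb
  have hbm : b ∈ Icc s T := cl_mem hsT.le _
  have hSb : Continuous fun t => S (max (cl s T t) b) b x :=
    (hScont b hbm x).comp_continuous (by fun_prop)
      (fun t => ⟨le_max_right _ _, max_le (cl_mem hsT.le _).2 hbm.2⟩)
  let a : ℝ × ℝ → ℝ := fun q => cl s T q.2
  let r : ℝ × ℝ → ℝ := fun q => cl s T q.1
  let F : ℝ × ℝ → ℝ := fun q => (|e (max (a q) (min (r q) b) - a q)| +
    |e (max b (min (r q) (a q)) - b)|) +
    ‖S (max (cl s T q.1) b) b x - S (max (cl s T t0) b) b x‖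
  have ha : Continuous a := by fun_prop
  have hr : Continuous r := by fun_prop
  have hF : Continuous F := by
    have := hSb.comp (continuous_fst (X := ℝ) (Y := ℝ))
    simp only [Function.comp_def] at this
    refine Continuous.add (Continuous.add ?_ ?_) (this.sub continuous_const).norm
    · exact (he.comp (by fun_prop)).abs
    · exact (he.comp (by fun_prop)).abs
  have hF0 : F (t0, τ0) = 0 := by
    have : a (t0, τ0) = b := rfl
    simp [F, this, he0]
  have hFt := hF.tendsto (t0, τ0)
  rw [hF0] at hFt
  refine squeeze_zero (fun _ => norm_nonneg _) (fun q => ?_) hFt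
  have hr' : r q ∈ Icc s T := cl_mem hsT.le _
  have ha' : a q ∈ Icc s T := cl_mem hsT.le _
  have h1 : ‖S (max (r q) (a q)) (a q) x - S (max (r q) b) b x‖ ≤
      |e (max (a q) (min (r q) b) - a q)| + |e (max b (min (r q) (a q)) - b)| := by
    rcases le_total (a q) b with h | h
    · refine (Sdiff hU0 hUadd hUiso hUcont hM hB hBM hScont hSeq ha'.1 h hbm.2 hr'.1 hr'.2 x).trans ?_
      exact (le_abs_self _).trans (le_add_of_nonneg_right (abs_nonneg _))
    · rw [norm_sub_rev]
      refine (Sdiff hU0 hUadd hUiso hUcont hM hB hBM hScont hSeq hbm.1 h ha'.2 hr'.1 hr'.2 x).trans ?_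
      exact (le_abs_self _).trans (le_add_of_nonneg_left (abs_nonneg _))
  exact (norm_sub_le_norm_sub_add_norm_sub _ (S (max (r q) b) b x) _).trans (add_le_add h1 le_rfl)

include hU0 hUadd hUiso hUcont hsT hM hB hBM hScont hSeq in
lemma Se_joint : Continuous fun q : (ℝ × ℝ) × X => Se S s T q.1 q.2 :=
  joint (Se_bound hUiso hsT hM hBM hScont hSeq)
    (Se_cont hU0 hUadd hUiso hUcont hsT hM hB hBM hScont hSeq)

variable {h : ℝ → X} (hh : IntegrableOn h (Icc s T)) (ws : X)

include hU0 hUadd hUiso hUcont hsT hM hB hBM hScont hSeq hh in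
lemma Sh_int (t : ℝ) : IntegrableOn (fun τ => Se S s T (t, τ) (h τ)) (Icc s T) := by
  refine Integrable.mono' (hh.norm.const_mul (Real.exp (M * (T - s)))) ?_
    (Filter.Eventually.of_forall fun τ => Se_bound hUiso hsT hM hBM hScont hSeq _ _)
  have := (Se_joint hU0 hUadd hUiso hUcont hsT hM hB hBM hScont hSeq).comp_aestronglyMeasurable
    (f := fun τ : ℝ => ((t, τ), h τ)) (μ := volume.restrict (Icc s T))
    (((by fun_prop : Continuous fun τ : ℝ => (t, τ)).aestronglyMeasurable).prodMk
      hh.aestronglyMeasurable)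
  exact this

/-- the candidate -/
noncomputable def Z (S : ℝ → ℝ → X →L[ℝ] X) (s : ℝ) (h : ℝ → X) (ws : X) (t : ℝ) : X :=
  S t s ws + ∫ τ in s..t, S t τ (h τ)

omit [CompleteSpace X] in
lemma Z_int_eq {t : ℝ} (ht : t ∈ Icc s T) :
    ∫ τ in s..t, S t τ (h τ) = ∫ τ in Icc s T, (Iic t).indicator
      (fun τ => Se S s T (t, τ) (h τ)) τ := by
  rw [setIntegral_indicator measurableSet_Iic, intervalIntegral.integral_of_le ht.1,
    ← integral_Icc_eq_integral_Ioc]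
  have : Icc s T ∩ Iic t = Icc s t := by
    ext x; simp only [mem_inter_iff, mem_Icc, mem_Iic]
    constructor
    · rintro ⟨⟨a, b⟩, c⟩; exact ⟨a, c⟩
    · rintro ⟨a, c⟩; exact ⟨⟨a, c.trans ht.2⟩, c⟩
  rw [this]
  apply setIntegral_congr_fun measurableSet_Icc
  intro τ hτ
  simp only
  rw [Se_eq hτ.1 hτ.2 ht.2]

include hU0 hUadd hUiso hUcont hsT hM hB hBM hScont hSeq hh in
lemma Z_cont : ContinuousOn (Z S s h ws) (Icc s T) := by
  refine ContinuousOn.add (hScont s ⟨le_rfl, hsT.le⟩ ws) ?_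
  refine ContinuousOn.congr (f := fun t => ∫ τ in Icc s T, (Iic t).indicator
      (fun τ => Se S s T (t, τ) (h τ)) τ) ?_ (fun t ht => Z_int_eq ht)
  apply Continuous.continuousOn
  rw [continuous_iff_continuousAt]
  intro t0
  apply continuousAt_of_dominated (bound := fun τ => Real.exp (M * (T - s)) * ‖h τ‖)
  · refine Filter.Eventually.of_forall fun t => ?_
    exact (Sh_int hU0 hUadd hUiso hUcont hsT hM hB hBM hScont hSeq hh t).aestronglyMeasurable.indicator
      measurableSet_Iic
  · refine Filter.Eventually.of_forall fun t => Filter.Eventually.of_forall fun τ => ?_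
    exact (norm_indicator_le_norm_self _ _).trans (Se_bound hUiso hsT hM hBM hScont hSeq _ _)
  · exact hh.norm.const_mul _
  · have hne : ∀ᵐ τ ∂(volume.restrict (Icc s T)), τ ≠ t0 :=
      ae_restrict_of_ae (Measure.ae_ne volume t0)
    filter_upwards [hne] with τ hτ
    rcases lt_or_gt_of_ne hτ with h1 | h1
    · have hc : ContinuousAt (fun t => Se S s T (t, τ) (h τ)) t0 :=
        ((Se_cont hU0 hUadd hUiso hUcont hsT hM hB hBM hScont hSeq (h τ)).comp
          (by fun_prop : Continuous fun t : ℝ => (t, τ))).continuousAt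
      refine hc.congr ?_
      filter_upwards [lt_mem_nhds h1] with t ht
      rw [indicator_of_mem (by exact ht.le)]
    · refine (continuousAt_const (y := (0 : X))).congr ?_
      filter_upwards [gt_mem_nhds h1] with t ht
      rw [indicator_of_notMem (by simpa using ht)]

include hU0 hUadd hUiso hUcont hsT hM hB hBM hScont hSeq hh in
lemma fub {t : ℝ} (ht : t ∈ Icc s T) :
    ∫ r in s..t, U (t - r) (B r (∫ τ in s..r, S r τ (h τ))) =
      ∫ τ in s..t, (S t τ (h τ) - U (t - τ) (h τ)) := by
  have hSi := Sh_int hU0 hUadd hUiso hUcont hsT hM hB hBM hScont hSeq hh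
  set μ := volume.restrict (Ioc s t) with hμ
  have hsub : Ioc s t ⊆ Icc s T := fun x hx => ⟨hx.1.le, hx.2.trans ht.2⟩
  have hhμ : Integrable h μ := hh.mono_set hsub
  let K : ℝ × ℝ → X := fun q => U (t - q.1) (B q.1 (Se S s T q (h q.2)))
  let D : Set (ℝ × ℝ) := {q | q.2 ≤ q.1}
  have hD : MeasurableSet D := measurableSet_le measurable_snd measurable_fst
  have hC : (0:ℝ) ≤ Real.exp (M * (T - s)) := (Real.exp_pos _).le
  have hKm : AEStronglyMeasurable K (μ.prod μ) := by
    have h1 : AEStronglyMeasurable (fun q : ℝ × ℝ => Se S s T q (h q.2)) (μ.prod μ) :=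
      (Se_joint hU0 hUadd hUiso hUcont hsT hM hB hBM hScont hSeq).comp_aestronglyMeasurable
        (f := fun q : ℝ × ℝ => (q, h q.2))
        (continuous_id.aestronglyMeasurable.prodMk hhμ.aestronglyMeasurable.comp_snd)
    have h2 : Continuous fun q : ℝ × X => U (t - q.1) (B q.1 q.2) := by
      have h3 : Continuous fun q : ℝ × X => B q.1 q.2 :=
        (hB.comp continuous_fst).clm_apply continuous_snd
      exact (Ujoint hUiso hUcont).comp
        ((by fun_prop : Continuous fun q : ℝ × X => t - q.1).prodMk h3)
    exact h2.comp_aestronglyMeasurable (f := fun q : ℝ × ℝ => (q.1, Se S s T q (h q.2)))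
      (continuous_fst.aestronglyMeasurable.prodMk h1)
  have hKi : Integrable (D.indicator K) (μ.prod μ) := by
    refine Integrable.indicator ?_ hD
    refine Integrable.mono' (g := fun q : ℝ × ℝ => M * (Real.exp (M * (T - s)) * ‖h q.2‖)) ?_ hKm
      (Filter.Eventually.of_forall fun q => ?_)
    · exact ((hhμ.norm.comp_snd μ).const_mul _).const_mul _
    · refine (kbound hUiso hBM _ _ _).trans ?_
      gcongr
      exact Se_bound hUiso hsT hM hBM hScont hSeq _ _
  have hswap := integral_integral_swap (f := fun r τ => D.indicator K (r, τ)) hKi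
  have hL : ∫ r in s..t, U (t - r) (B r (∫ τ in s..r, S r τ (h τ))) =
      ∫ r, ∫ τ, D.indicator K (r, τ) ∂μ ∂μ := by
    rw [intervalIntegral.integral_of_le ht.1]
    apply setIntegral_congr_fun measurableSet_Ioc
    intro r hr
    simp only
    have e1 : ∀ τ, D.indicator K (r, τ) = (Iic r).indicator (fun τ => K (r, τ)) τ := fun τ => by
      simp only [indicator, D, mem_ofPred_eq, mem_Iic]
    simp only [e1]
    rw [setIntegral_indicator measurableSet_Iic]
    have e2 : Ioc s t ∩ Iic r = Ioc s r := by
      ext x; simp only [mem_inter_iff, mem_Ioc, mem_Iic]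
      exact ⟨fun ⟨⟨a, b⟩, c⟩ => ⟨a, c⟩, fun ⟨a, c⟩ => ⟨⟨a, c.trans hr.2⟩, c⟩⟩
    have e3 : ∫ τ in s..r, S r τ (h τ) = ∫ τ in Ioc s r, Se S s T (r, τ) (h τ) := by
      rw [intervalIntegral.integral_of_le hr.1.le]
      apply setIntegral_congr_fun measurableSet_Ioc
      intro τ hτ
      simp only
      rw [Se_eq hτ.1.le hτ.2 (hr.2.trans ht.2)]
    rw [e2, e3, ← ContinuousLinearMap.comp_apply, ← ContinuousLinearMap.integral_comp_comm]
    · rfl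
    · exact (hSi r).mono_set (fun x hx => ⟨hx.1.le, hx.2.trans (hr.2.trans ht.2)⟩)
  rw [hL, hswap, intervalIntegral.integral_of_le ht.1]
  apply setIntegral_congr_fun measurableSet_Ioc
  intro τ hτ
  simp only
  have e1 : ∀ r, D.indicator K (r, τ) = (Ici τ).indicator (fun r => K (r, τ)) r := fun r => by
    simp only [indicator, D, mem_ofPred_eq, mem_Ici]
  simp only [e1]
  rw [setIntegral_indicator measurableSet_Ici]
  have e2 : Ioc s t ∩ Ici τ = Icc τ t := by
    ext x; simp only [mem_inter_iff, mem_Ioc, mem_Ici, mem_Icc]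
    exact ⟨fun ⟨⟨a, b⟩, c⟩ => ⟨c, b⟩, fun ⟨a, c⟩ => ⟨⟨hτ.1.trans_le a, c⟩, a⟩⟩
  rw [e2, integral_Icc_eq_integral_Ioc, hSeq τ (hsub hτ) (h τ) t ⟨hτ.2, ht.2⟩,
    add_sub_cancel_left, intervalIntegral.integral_of_le hτ.2]
  apply setIntegral_congr_fun measurableSet_Ioc
  intro r hr
  simp only [K]
  rw [Se_eq hτ.1.le hr.1.le (hr.2.trans ht.2)]

include hUiso hUcont hh in
omit [CompleteSpace X] in
lemma Uh_int {t : ℝ} (ht : t ∈ Icc s T) :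
    IntervalIntegrable (fun τ => U (t - τ) (h τ)) volume s t := by
  rw [intervalIntegrable_iff_integrableOn_Ioc_of_le ht.1]
  have hsub : Ioc s t ⊆ Icc s T := fun x hx => ⟨hx.1.le, hx.2.trans ht.2⟩
  have hhμ := hh.mono_set hsub
  refine Integrable.mono' hhμ.norm ?_ (Filter.Eventually.of_forall fun τ => (hUiso _ _).le)
  exact (Ujoint hUiso hUcont).comp_aestronglyMeasurable (f := fun τ : ℝ => (t - τ, h τ))
    ((by fun_prop : Continuous fun τ : ℝ => t - τ).aestronglyMeasurable.prodMk
      hhμ.aestronglyMeasurable)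

include hUiso hUcont hh hB in
omit [CompleteSpace X] in
lemma split {w : ℝ → X} (hw : ContinuousOn w (Icc s T)) {t : ℝ} (ht : t ∈ Icc s T) :
    U (t - s) ws + ∫ τ in s..t, U (t - τ) (B τ (w τ) + h τ) =
      (U (t - s) ws + ∫ τ in s..t, U (t - τ) (h τ)) + ∫ τ in s..t, U (t - τ) (B τ (w τ)) := by
  simp only [map_add]
  rw [intervalIntegral.integral_add _ (Uh_int hUiso hUcont hh ht)]
  · abel
  · apply ContinuousOn.intervalIntegrable
    rw [uIcc_of_le ht.1]
    exact kcont hUiso hUcont hB (hw.mono (Icc_subset_Icc_right ht.2)) t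

include hU0 hUadd hUiso hUcont hsT hM hB hBM hScont hSeq hh in
lemma Z_eq {t : ℝ} (ht : t ∈ Icc s T) :
    Z S s h ws t = U (t - s) ws + ∫ τ in s..t, U (t - τ) (B τ (Z S s h ws τ) + h τ) := by
  have hZ := Z_cont hU0 hUadd hUiso hUcont hsT hM hB hBM hScont hSeq hh ws
  have hsm : s ∈ Icc s T := ⟨le_rfl, hsT.le⟩
  have hI : ∀ {w : ℝ → X}, ContinuousOn w (Icc s T) →
      IntervalIntegrable (fun τ => U (t - τ) (B τ (w τ))) volume s t := fun hw => by
    apply ContinuousOn.intervalIntegrable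
    rw [uIcc_of_le ht.1]
    exact kcont hUiso hUcont hB (hw.mono (Icc_subset_Icc_right ht.2)) t
  have hZ2 : ContinuousOn (fun t => ∫ τ in s..t, S t τ (h τ)) (Icc s T) := by
    refine (hZ.sub (hScont s hsm ws)).congr fun t _ => ?_
    simp [Z]
  rw [split hUiso hUcont hB hh ws hZ ht]
  have e1 : ∫ τ in s..t, U (t - τ) (B τ (Z S s h ws τ)) =
      (∫ τ in s..t, U (t - τ) (B τ (S τ s ws))) +
        ∫ r in s..t, U (t - r) (B r (∫ τ in s..r, S r τ (h τ))) := by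
    rw [← intervalIntegral.integral_add (hI (hScont s hsm ws)) (hI hZ2)]
    simp [Z]
  have hSI : IntervalIntegrable (fun τ => S t τ (h τ)) volume s t := by
    rw [intervalIntegrable_iff_integrableOn_Ioc_of_le ht.1]
    refine ((Sh_int hU0 hUadd hUiso hUcont hsT hM hB hBM hScont hSeq hh t).mono_set
      (fun x hx => ⟨hx.1.le, hx.2.trans ht.2⟩ : Ioc s t ⊆ Icc s T)).congr_fun ?_ measurableSet_Ioc
    intro τ hτ
    simp only
    rw [Se_eq hτ.1.le hτ.2 ht.2]
  rw [e1, fub hU0 hUadd hUiso hUcont hsT hM hB hBM hScont hSeq hh ht,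
    intervalIntegral.integral_sub hSI (Uh_int hUiso hUcont hh ht), Z, hSeq s hsm ws t ht]
  abel

include hUiso hsT hM hBM hScont hSeq hh in
lemma Z_bound {t : ℝ} (ht : t ∈ Icc s T) :
    ‖Z S s h ws t‖ ≤ Real.exp (M * (T - s)) * (‖ws‖ + ∫ τ in Icc s T, ‖h τ‖) := by
  rw [mul_add, Z, Z_int_eq ht]
  refine (norm_add_le _ _).trans (add_le_add
    (SboundC hUiso hM hBM hScont hSeq le_rfl ht.1 ht.2 ws) ?_)
  rw [← integral_const_mul]
  apply norm_integral_le_of_norm_le (hh.norm.const_mul _)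
  refine Filter.Eventually.of_forall fun τ => ?_
  exact (norm_indicator_le_norm_self _ _).trans (Se_bound hUiso hsT hM hBM hScont hSeq _ _)

end core
end Duh

/-- equivalence of the two Duhamel formulations for the inhomogeneous
equation, together with existence, uniqueness and the exponential estimate. -/
theorem stmt_3
    {X : Type*} [NormedAddCommGroup X] [NormedSpace ℝ X] [CompleteSpace X]
    (U : ℝ → X →L[ℝ] X)
    (hU0 : U 0 = ContinuousLinearMap.id ℝ X)
    (hUadd : ∀ a b : ℝ, U (a + b) = (U a).comp (U b))
    (hUiso : ∀ (t : ℝ) (x : X), ‖U t x‖ = ‖x‖)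
    (hUcont : ∀ x : X, Continuous fun t : ℝ => U t x)
    (s T M : ℝ) (hs : 0 ≤ s) (hsT : s < T) (hM : 0 ≤ M)
    (B : ℝ → X →L[ℝ] X)
    (hBcont : ContinuousOn B (Icc s T))
    (hBbound : ∀ t ∈ Icc s T, ‖B t‖ ≤ M)
    -- the evolution operator `S_B`, characterized by its Duhamel formula
    (S : ℝ → ℝ → X →L[ℝ] X)
    (hScont : ∀ s' ∈ Icc s T, ∀ x : X, ContinuousOn (fun t => S t s' x) (Icc s' T))
    (hSeq : ∀ s' ∈ Icc s T, ∀ x : X, ∀ t ∈ Icc s' T,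
      S t s' x = U (t - s') x + ∫ τ in s'..t, U (t - τ) (B τ (S τ s' x)))
    (h : ℝ → X) (hh : IntegrableOn h (Icc s T))
    (ws : X) :
    (∀ w : ℝ → X, ContinuousOn w (Icc s T) →
      ((∀ t ∈ Icc s T,
          w t = U (t - s) ws + ∫ τ in s..t, U (t - τ) (B τ (w τ) + h τ)) ↔
       (∀ t ∈ Icc s T,
          w t = S t s ws + ∫ τ in s..t, S t τ (h τ)))) ∧
    (∃ w : ℝ → X, ContinuousOn w (Icc s T) ∧
      (∀ t ∈ Icc s T,
        w t = U (t - s) ws + ∫ τ in s..t, U (t - τ) (B τ (w τ) + h τ)) ∧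
      (∀ t ∈ Icc s T,
        ‖w t‖ ≤ Real.exp (M * (T - s)) * (‖ws‖ + ∫ τ in Icc s T, ‖h τ‖))) ∧
    (∀ w₁ w₂ : ℝ → X, ContinuousOn w₁ (Icc s T) → ContinuousOn w₂ (Icc s T) →
      (∀ t ∈ Icc s T,
        w₁ t = U (t - s) ws + ∫ τ in s..t, U (t - τ) (B τ (w₁ τ) + h τ)) →
      (∀ t ∈ Icc s T,
        w₂ t = U (t - s) ws + ∫ τ in s..t, U (t - τ) (B τ (w₂ τ) + h τ)) →
      EqOn w₁ w₂ (Icc s T)) := by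
  have hcong : ∀ (a : ℝ), s ≤ a → ∀ t ∈ Icc a T, ∀ f g : ℝ → X,
      (∫ τ in a..t, U (t - τ) (B (Duh.cl s T τ) (f τ) + g τ)) =
        ∫ τ in a..t, U (t - τ) (B τ (f τ) + g τ) := by
    intro a ha t ht f g
    apply intervalIntegral.integral_congr
    intro τ hτ
    rw [uIcc_of_le ht.1] at hτ
    simp only
    rw [Duh.cl_eq ⟨ha.trans hτ.1, hτ.2.trans ht.2⟩]
  have hB : Continuous fun t => B (Duh.cl s T t) :=
    hBcont.comp_continuous (Duh.cl_cont s T) (Duh.cl_mem hsT.le)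
  have hBM : ∀ t, ‖B (Duh.cl s T t)‖ ≤ M := fun t => hBbound _ (Duh.cl_mem hsT.le t)
  have hSeq' : ∀ s' ∈ Icc s T, ∀ x : X, ∀ t ∈ Icc s' T,
      S t s' x = U (t - s') x +
        ∫ τ in s'..t, U (t - τ) ((fun t => B (Duh.cl s T t)) τ (S τ s' x)) := by
    intro s' hs' x t ht
    have := hcong s' hs'.1 t ht (fun τ => S τ s' x) 0
    simp only [Pi.zero_apply, add_zero] at this
    simp only
    rw [this]
    exact hSeq s' hs' x t ht
  have hZc := Duh.Z_cont hU0 hUadd hUiso hUcont hsT hM hB hBM hScont hSeq' hh ws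
  have hZe : ∀ t ∈ Icc s T, Duh.Z S s h ws t = U (t - s) ws +
      ∫ τ in s..t, U (t - τ) (B τ (Duh.Z S s h ws τ) + h τ) := by
    intro t ht
    rw [← hcong s le_rfl t ht]
    exact Duh.Z_eq hU0 hUadd hUiso hUcont hsT hM hB hBM hScont hSeq' hh ws ht
  have huniq : ∀ w₁ w₂ : ℝ → X, ContinuousOn w₁ (Icc s T) → ContinuousOn w₂ (Icc s T) →
      (∀ t ∈ Icc s T,
        w₁ t = U (t - s) ws + ∫ τ in s..t, U (t - τ) (B τ (w₁ τ) + h τ)) →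
      (∀ t ∈ Icc s T,
        w₂ t = U (t - s) ws + ∫ τ in s..t, U (t - τ) (B τ (w₂ τ) + h τ)) →
      EqOn w₁ w₂ (Icc s T) := by
    intro w₁ w₂ c₁ c₂ e₁ e₂
    refine Duh.uniq hUiso hUcont hB hM hBM c₁ c₂
      (g := fun t => U (t - s) ws + ∫ τ in s..t, U (t - τ) (h τ)) ?_ ?_
    · intro t ht
      rw [← Duh.split hUiso hUcont hB hh ws c₁ ht, hcong s le_rfl t ht]
      exact e₁ t ht
    · intro t ht
      rw [← Duh.split hUiso hUcont hB hh ws c₂ ht, hcong s le_rfl t ht]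
      exact e₂ t ht
  refine ⟨fun w hw => ⟨fun e => huniq w _ hw hZc e hZe, fun e t ht => ?_⟩,
    ⟨_, hZc, hZe, fun t ht => Duh.Z_bound hUiso hsT hM hBM hScont hSeq' hh ws ht⟩, huniq⟩
  have hwZ : EqOn w (Duh.Z S s h ws) (Icc s T) := e
  rw [hwZ ht, hZe t ht]
  congr 1
  apply intervalIntegral.integral_congr
  intro τ hτ
  rw [uIcc_of_le ht.1] at hτ
  simp only
  rw [hwZ ⟨hτ.1, hτ.2.trans ht.2⟩]
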